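/- arXiv:0910.3640 — 3 statements merged into one kernel-verified Lean document; each statement's English description precedes it below -/
import Mathlib

section
/- Let f : ℝ³ → ℝ be measurable with 0 ≤ f ≤ 1 and f ∈ L¹(ℝ³). Then Q(f) ∈ L¹(ℝ³) with ∫_{ℝ³} |Q(f)(v)| dv ≤ 2 B ∫_{ℝ³} f(v) dv. -/
open MeasureTheory Metric
open scoped RealInnerProductSpace ENNReal

noncomputable section

/-- Euclidean space `ℝ³`. -/
abbrev R3 : Type := EuclideanSpace ℝ (Fin 3)

/-- The unit sphere `S² ⊂ ℝ³`. -/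
abbrev S2 : Type := sphere (0 : R3) 1

/-- The surface measure on the unit sphere `S²`. -/
def sphMeasure : Measure S2 := (volume : Measure R3).toSphere

/-- The precollisional velocity `v' = v - ((v - v*)·ω) ω`. -/
def vPrime (v vs : R3) (ω : S2) : R3 := v - ⟪v - vs, (ω : R3)⟫ • (ω : R3)

/-- The precollisional velocity `v*' = v* + ((v - v*)·ω) ω`. -/
def vsPrime (v vs : R3) (ω : S2) : R3 := vs + ⟪v - vs, (ω : R3)⟫ • (ω : R3)

/-- The Boltzmann–Fermi–Dirac collision operator with collision kernel `b`:
`Q(f)(v) = ∫_{S²} ∫_{ℝ³} b(v - v*, ω) [f' f*' (1-f)(1-f*) - f f* (1-f')(1-f*')] dv* dω`. -/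
def Qcoll (b : R3 × S2 → ℝ) (f : R3 → ℝ) (v : R3) : ℝ :=
  ∫ ω : S2, ∫ vs : R3,
      b (v - vs, ω) *
        (f (vPrime v vs ω) * f (vsPrime v vs ω) * (1 - f v) * (1 - f vs)
          - f v * f vs * (1 - f (vPrime v vs ω)) * (1 - f (vsPrime v vs ω)))
    ∂(volume : Measure R3) ∂sphMeasure

lemma measurable_H (b : R3 × S2 → ℝ) (hb_meas : Measurable b)
    (f : R3 → ℝ) (hf_meas : Measurable f) :
    Measurable (fun p : (R3 × S2) × R3 => b (p.1.1 - p.2, p.1.2) *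
        (f (vPrime p.1.1 p.2 p.1.2) * f (vsPrime p.1.1 p.2 p.1.2) * (1 - f p.1.1) * (1 - f p.2)
          - f p.1.1 * f p.2 * (1 - f (vPrime p.1.1 p.2 p.1.2))
            * (1 - f (vsPrime p.1.1 p.2 p.1.2)))) := by
  have h1 : Measurable (fun p : (R3 × S2) × R3 => vPrime p.1.1 p.2 p.1.2) := by
    unfold vPrime
    apply Continuous.measurable
    fun_prop
  have h2 : Measurable (fun p : (R3 × S2) × R3 => vsPrime p.1.1 p.2 p.1.2) := by
    unfold vsPrime
    apply Continuous.measurable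
    fun_prop
  have h3 := hf_meas.comp h1
  have h4 := hf_meas.comp h2
  simp only [Function.comp_def] at h3 h4
  fun_prop

lemma H_bound (x a c d e : ℝ) (hx : 0 ≤ x) (ha : 0 ≤ a) (ha1 : a ≤ 1) (hc : 0 ≤ c) (hc1 : c ≤ 1)
    (hd : 0 ≤ d) (hd1 : d ≤ 1) (he : 0 ≤ e) (he1 : e ≤ 1) :
    |x * (a * c * (1 - d) * (1 - e) - d * e * (1 - a) * (1 - c))| ≤ x * (a + d) := by
  rw [abs_mul, abs_of_nonneg hx]
  apply mul_le_mul_of_nonneg_left _ hx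
  have key : ∀ p q r s : ℝ, 0 ≤ p → 0 ≤ q → q ≤ 1 → 0 ≤ r → r ≤ 1 → 0 ≤ s → s ≤ 1 →
      0 ≤ p * q * (1 - r) * (1 - s) ∧ p * q * (1 - r) * (1 - s) ≤ p := by
    intro p q r s hp hq hq1 hr hr1 hs hs1
    have h1 : 0 ≤ 1 - r := by linarith
    have h2 : 0 ≤ 1 - s := by linarith
    refine ⟨by positivity, ?_⟩
    calc p * q * (1 - r) * (1 - s) ≤ p * q * (1 - r) :=
          mul_le_of_le_one_right (by positivity) (by linarith)
      _ ≤ p * q := mul_le_of_le_one_right (by positivity) (by linarith)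
      _ ≤ p := mul_le_of_le_one_right hp hq1
  have k1 := key a c d e ha hc hc1 hd hd1 he he1
  have k2 := key d e a c hd he he1 ha ha1 hc hc1
  rw [abs_le]
  constructor <;> linarith [k1.1, k1.2, k2.1, k2.2]

instance : SFinite sphMeasure := by unfold sphMeasure; infer_instance

lemma lint_bound
    (b : R3 × S2 → ℝ) (hb_meas : Measurable b) (hb_nonneg : ∀ p, 0 ≤ b p)
    (f : R3 → ℝ) (hf_meas : Measurable f) (hf0 : ∀ v, 0 ≤ f v) (hf1 : ∀ v, f v ≤ 1) :
    ∫⁻ v, ‖Qcoll b f v‖ₑ ≤ 2 * (∫⁻ p, ENNReal.ofReal (b p) ∂((volume : Measure R3).prod sphMeasure))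
      * ∫⁻ v, ENNReal.ofReal (f v) := by
  have hpt : ∀ v, ‖Qcoll b f v‖ₑ ≤ ∫⁻ ω : S2, ∫⁻ u : R3, ENNReal.ofReal (b (u, ω)) *
      (ENNReal.ofReal (f (v - ⟪u, (ω : R3)⟫ • (ω : R3))) + ENNReal.ofReal (f v)) ∂volume
        ∂sphMeasure := by
    intro v
    unfold Qcoll
    refine (enorm_integral_le_lintegral_enorm _).trans (lintegral_mono fun ω => ?_)
    refine (enorm_integral_le_lintegral_enorm _).trans ?_
    rw [← lintegral_sub_left_eq_self _ v]
    refine lintegral_mono fun u => ?_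
    rw [← ENNReal.ofReal_add (hf0 _) (hf0 _), ← ENNReal.ofReal_mul (hb_nonneg _),
      Real.enorm_eq_ofReal_abs]
    apply ENNReal.ofReal_le_ofReal
    have := H_bound (b (u, ω)) (f (vPrime v (v - u) ω)) (f (vsPrime v (v - u) ω)) (f v) (f (v - u))
      (hb_nonneg _) (hf0 _) (hf1 _) (hf0 _) (hf1 _) (hf0 _) (hf1 _) (hf0 _) (hf1 _)
    simpa [vPrime] using this
  have hm : Measurable (fun p : (R3 × S2) × R3 => ENNReal.ofReal (b (p.2, p.1.2)) *
      (ENNReal.ofReal (f (p.1.1 - ⟪p.2, (p.1.2 : R3)⟫ • (p.1.2 : R3)))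
        + ENNReal.ofReal (f p.1.1))) := by
    have h1 : Measurable (fun p : (R3 × S2) × R3 =>
        p.1.1 - ⟪p.2, (p.1.2 : R3)⟫ • (p.1.2 : R3)) := by
      apply Continuous.measurable
      fun_prop
    have h3 := hf_meas.comp h1
    simp only [Function.comp_def] at h3
    fun_prop
  refine (lintegral_mono hpt).trans (le_of_eq ?_)
  rw [lintegral_lintegral_swap (hm.lintegral_prod_right').aemeasurable]
  have hin : ∀ ω : S2, ∫⁻ v : R3, ∫⁻ u : R3, ENNReal.ofReal (b (u, ω)) *
      (ENNReal.ofReal (f (v - ⟪u, (ω : R3)⟫ • (ω : R3))) + ENNReal.ofReal (f v))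
      = (∫⁻ u : R3, ENNReal.ofReal (b (u, ω))) * (2 * ∫⁻ v, ENNReal.ofReal (f v)) := by
    intro ω
    rw [lintegral_lintegral_swap]
    · rw [← lintegral_mul_const _ (by fun_prop)]
      refine lintegral_congr fun u => ?_
      rw [lintegral_const_mul _ (by fun_prop), lintegral_add_right _ (by fun_prop),
        lintegral_sub_right_eq_self (fun v => ENNReal.ofReal (f v)), two_mul]
    · exact (hm.comp (g := fun p : (R3 × S2) × R3 => _)
        (f := fun q : R3 × R3 => ((q.1, ω), q.2)) (by fun_prop)).aemeasurable
  simp_rw [hin]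
  have hmb : Measurable (fun p : R3 × S2 => ENNReal.ofReal (b p)) := by fun_prop
  rw [lintegral_mul_const _ hmb.lintegral_prod_left',
    lintegral_prod_symm _ hmb.aemeasurable]
  ring

/-- If `0 ≤ f ≤ 1` is measurable and integrable, then `Q(f) ∈ L¹(ℝ³)` with
`∫ |Q(f)(v)| dv ≤ 2 B ∫ f(v) dv`. -/
theorem Qcoll_L1_bound
    (b : R3 × S2 → ℝ) (hb_meas : Measurable b) (hb_nonneg : ∀ p, 0 ≤ b p)
    (hb_int : Integrable b ((volume : Measure R3).prod sphMeasure))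
    (B : ℝ) (hB : B = ∫ p, b p ∂((volume : Measure R3).prod sphMeasure))
    (f : R3 → ℝ) (hf_meas : Measurable f) (hf0 : ∀ v, 0 ≤ f v) (hf1 : ∀ v, f v ≤ 1)
    (hf_int : Integrable f (volume : Measure R3)) :
    Integrable (Qcoll b f) (volume : Measure R3) ∧
    ∫ v, |Qcoll b f v| ∂(volume : Measure R3) ≤ 2 * B * ∫ v, f v ∂(volume : Measure R3) := by
  have hL := lint_bound b hb_meas hb_nonneg f hf_meas hf0 hf1
  have hBi := ofReal_integral_eq_lintegral_ofReal hb_int (ae_of_all _ hb_nonneg)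
  have hfi := ofReal_integral_eq_lintegral_ofReal hf_int (ae_of_all _ hf0)
  have hB0 : 0 ≤ B := hB ▸ integral_nonneg hb_nonneg
  have hI0 : 0 ≤ ∫ v, f v := integral_nonneg hf0
  rw [← hBi, ← hfi, ← hB] at hL
  have h2 : 2 * ENNReal.ofReal B * ENNReal.ofReal (∫ v, f v)
      = ENNReal.ofReal (2 * B * ∫ v, f v) := by
    rw [ENNReal.ofReal_mul (by positivity), ENNReal.ofReal_mul (by norm_num), ENNReal.ofReal_ofNat]
  rw [h2] at hL
  have hsm : StronglyMeasurable (Qcoll b f) := by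
    unfold Qcoll
    exact ((measurable_H b hb_meas f hf_meas).stronglyMeasurable.integral_prod_right').integral_prod_right'
  refine ⟨⟨hsm.aestronglyMeasurable, hL.trans_lt ENNReal.ofReal_lt_top⟩, ?_⟩
  have := integral_norm_eq_lintegral_enorm hsm.aestronglyMeasurable (μ := (volume : Measure R3))
  simp only [Real.norm_eq_abs] at this
  rw [this]
  exact ENNReal.toReal_le_of_le_ofReal (by positivity) hL
end
end

section
/- Let f : ℝ³ → ℝ be measurable with 0 ≤ f ≤ 1 and ∫_{ℝ³} |v|² f(v) dv < ∞. Then ∫_{ℝ³} |v|² |Q(f)(v)| dv ≤ 3 B ∫_{ℝ³} |v|² f(v) dv. -/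
open MeasureTheory Metric
open scoped RealInnerProductSpace ENNReal

noncomputable section

instance sphMeasure_finite : IsFiniteMeasure sphMeasure := by
  unfold sphMeasure; infer_instance

/-- The collision map as a linear map, for fixed `ω`. -/
def collLin (ω : S2) : (R3 × R3) →ₗ[ℝ] (R3 × R3) where
  toFun p := (vPrime p.1 p.2 ω, vsPrime p.1 p.2 ω)
  map_add' p q := by
    ext i <;> simp [vPrime, vsPrime, inner_sub_left, inner_add_left] <;> ring
  map_smul' c p := by
    ext i <;> simp [vPrime, vsPrime, inner_sub_left, inner_smul_left] <;> ring

lemma inner_omega (ω : S2) : ⟪(ω : R3), (ω : R3)⟫ = 1 := by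
  rw [real_inner_self_eq_norm_sq]; simp

lemma sub_prime (v vs : R3) (ω : S2) :
    vPrime v vs ω - vsPrime v vs ω = (v - vs) - (2 * ⟪v - vs, (ω : R3)⟫) • (ω : R3) := by
  unfold vPrime vsPrime
  module

lemma inner_prime (v vs : R3) (ω : S2) :
    ⟪vPrime v vs ω - vsPrime v vs ω, (ω : R3)⟫ = - ⟪v - vs, (ω : R3)⟫ := by
  rw [sub_prime, inner_sub_left, inner_smul_left, inner_omega]
  simp; ring

lemma norm_prime (v vs : R3) (ω : S2) :
    ‖vPrime v vs ω - vsPrime v vs ω‖ = ‖v - vs‖ := by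
  rw [sub_prime, ← sq_eq_sq₀ (norm_nonneg _) (norm_nonneg _), norm_sub_sq_real, norm_smul,
    inner_smul_right]
  have : ‖(ω : R3)‖ = 1 := by simp
  rw [this, mul_one, Real.norm_eq_abs, sq_abs]
  ring

lemma norm_vPrime_le (v vs : R3) (ω : S2) : ‖vPrime v vs ω‖ ^ 2 ≤ ‖v‖ ^ 2 + ‖vs‖ ^ 2 := by
  have h : ‖vPrime v vs ω‖ ^ 2 + ‖vsPrime v vs ω‖ ^ 2 = ‖v‖ ^ 2 + ‖vs‖ ^ 2 := by
    unfold vPrime vsPrime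
    rw [norm_sub_sq_real, norm_add_sq_real, norm_smul, inner_smul_right, inner_smul_right]
    have : ‖(ω : R3)‖ = 1 := by simp
    rw [this, mul_one, Real.norm_eq_abs, sq_abs, inner_sub_left]
    ring
  nlinarith [sq_nonneg ‖vsPrime v vs ω‖]

lemma collLin_invol (ω : S2) : collLin ω ∘ₗ collLin ω = LinearMap.id := by
  apply LinearMap.ext
  rintro ⟨v, vs⟩
  have h := inner_prime v vs ω
  simp only [collLin, LinearMap.comp_apply, LinearMap.coe_mk, AddHom.coe_mk, LinearMap.id_apply]
  rw [Prod.mk.injEq]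
  constructor
  · rw [vPrime, h]; unfold vPrime; module
  · rw [vsPrime, h]; unfold vsPrime; module

lemma collLin_mp (ω : S2) : MeasurePreserving (collLin ω)
    ((volume : Measure R3).prod volume) ((volume : Measure R3).prod volume) := by
  have hd : LinearMap.det (collLin ω) * LinearMap.det (collLin ω) = 1 := by
    rw [← LinearMap.det_comp, collLin_invol, LinearMap.det_id]
  have habs : |LinearMap.det (collLin ω)| = 1 := by
    rcases mul_self_eq_one_iff.1 hd with h | h <;> simp [h]
  refine ⟨(collLin ω).continuous_of_finiteDimensional.measurable, ?_⟩
  rw [Measure.map_linearMap_addHaar_eq_smul_addHaar _ (by intro h; simp [h] at hd), abs_inv, habs]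
  simp

lemma measurable_prime : Measurable (fun p : (R3 × S2) × R3 => vPrime p.1.1 p.2 p.1.2) := by
  unfold vPrime
  apply Continuous.measurable
  fun_prop

lemma measurable_sprime : Measurable (fun p : (R3 × S2) × R3 => vsPrime p.1.1 p.2 p.1.2) := by
  unfold vsPrime
  apply Continuous.measurable
  fun_prop

section core
variable (β : R3 × S2 → ℝ≥0∞) (g m : R3 → ℝ≥0∞)

/-- The mass bound, weight on the first variable. -/
lemma bound_one (hβ : Measurable β) (hg : Measurable g) (hm : Measurable m) (hg1 : ∀ v, g v ≤ 1)
    (ω : S2) :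
    ∫⁻ v, ∫⁻ vs, m v * (β (v - vs, ω) * (g v * g vs)) ≤
      (∫⁻ w, β (w, ω)) * ∫⁻ v, m v * g v := by
  rw [← lintegral_const_mul _ (by fun_prop)]
  apply lintegral_mono
  intro v
  calc ∫⁻ vs, m v * (β (v - vs, ω) * (g v * g vs))
      ≤ ∫⁻ vs, β (v - vs, ω) * (m v * g v) := by
        apply lintegral_mono
        intro vs
        calc m v * (β (v - vs, ω) * (g v * g vs)) ≤ m v * (β (v - vs, ω) * (g v * 1)) := by
              gcongr; exact hg1 vs
          _ = _ := by ring
    _ = (∫⁻ vs, β (v - vs, ω)) * (m v * g v) := lintegral_mul_const _ (by fun_prop)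
    _ = _ := by rw [lintegral_sub_left_eq_self (fun w => β (w, ω)) v]

lemma bound_two (hβ : Measurable β) (hg : Measurable g) (hm : Measurable m) (hg1 : ∀ v, g v ≤ 1)
    (ω : S2) :
    ∫⁻ v, ∫⁻ vs, m vs * (β (v - vs, ω) * (g v * g vs)) ≤
      (∫⁻ w, β (w, ω)) * ∫⁻ v, m v * g v := by
  rw [lintegral_lintegral_swap (by fun_prop), ← lintegral_const_mul _ (by fun_prop)]
  apply lintegral_mono
  intro vs
  calc ∫⁻ v, m vs * (β (v - vs, ω) * (g v * g vs))
      ≤ ∫⁻ v, β (v - vs, ω) * (m vs * g vs) := by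
        apply lintegral_mono
        intro v
        calc m vs * (β (v - vs, ω) * (g v * g vs)) ≤ m vs * (β (v - vs, ω) * (1 * g vs)) := by
              gcongr; exact hg1 v
          _ = _ := by ring
    _ = (∫⁻ v, β (v - vs, ω)) * (m vs * g vs) := lintegral_mul_const _ (by fun_prop)
    _ = _ := by rw [lintegral_sub_right_eq_self (fun w => β (w, ω)) vs]

lemma meas_vP (ω : S2) : Measurable (fun p : R3 × R3 => vPrime p.1 p.2 ω) := by
  unfold vPrime
  apply Continuous.measurable
  fun_prop

lemma meas_vsP (ω : S2) : Measurable (fun p : R3 × R3 => vsPrime p.1 p.2 ω) := by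
  unfold vsPrime
  apply Continuous.measurable
  fun_prop

lemma bound_gain (hβ : Measurable β) (hg : Measurable g) (hm : Measurable m) (hg1 : ∀ v, g v ≤ 1)
    (hsym : ∀ v vs ω, β (vPrime v vs ω - vsPrime v vs ω, ω) = β (v - vs, ω))
    (hmp : ∀ v vs ω, m (vPrime v vs ω) ≤ m v + m vs) (ω : S2) :
    ∫⁻ v, ∫⁻ vs, m v * (β (v - vs, ω) * (g (vPrime v vs ω) * g (vsPrime v vs ω))) ≤
      2 * ((∫⁻ w, β (w, ω)) * ∫⁻ v, m v * g v) := by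
  have h1 := meas_vP ω
  have h2 := meas_vsP ω
  have hinv : ∀ p : R3 × R3, vPrime (vPrime p.1 p.2 ω) (vsPrime p.1 p.2 ω) ω = p.1 ∧
      vsPrime (vPrime p.1 p.2 ω) (vsPrime p.1 p.2 ω) ω = p.2 := by
    intro p
    have := LinearMap.congr_fun (collLin_invol ω) p
    exact ⟨congrArg Prod.fst this, congrArg Prod.snd this⟩
  have hM : Measurable (fun p : R3 × R3 =>
      m p.1 * (β (p.1 - p.2, ω) * (g (vPrime p.1 p.2 ω) * g (vsPrime p.1 p.2 ω)))) := by
    fun_prop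
  rw [lintegral_lintegral (f := fun v vs =>
    m v * (β (v - vs, ω) * (g (vPrime v vs ω) * g (vsPrime v vs ω)))) hM.aemeasurable,
    ← (collLin_mp ω).lintegral_comp hM]
  calc _ ≤ ∫⁻ p : R3 × R3, (m p.1 * (β (p.1 - p.2, ω) * (g p.1 * g p.2)) +
          m p.2 * (β (p.1 - p.2, ω) * (g p.1 * g p.2))) ∂(volume.prod volume) := by
        apply lintegral_mono
        intro p
        change m (vPrime p.1 p.2 ω) * (β (vPrime p.1 p.2 ω - vsPrime p.1 p.2 ω, ω) *
          (g (vPrime (vPrime p.1 p.2 ω) (vsPrime p.1 p.2 ω) ω) *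
            g (vsPrime (vPrime p.1 p.2 ω) (vsPrime p.1 p.2 ω) ω))) ≤ _
        rw [(hinv p).1, (hinv p).2, hsym]
        beta_reduce
        rw [← add_mul]
        gcongr
        exact hmp _ _ _
    _ = (∫⁻ v, ∫⁻ vs, m v * (β (v - vs, ω) * (g v * g vs))) +
        ∫⁻ v, ∫⁻ vs, m vs * (β (v - vs, ω) * (g v * g vs)) := by
        rw [lintegral_add_left (by fun_prop), lintegral_prod _ (by fun_prop),
          lintegral_prod _ (by fun_prop)]
    _ ≤ _ := by
        rw [two_mul]
        exact add_le_add (bound_one β g m hβ hg hm hg1 ω) (bound_two β g m hβ hg hm hg1 ω)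

lemma bound_total (hβ : Measurable β) (hg : Measurable g) (hm : Measurable m) (hg1 : ∀ v, g v ≤ 1)
    (hsym : ∀ v vs ω, β (vPrime v vs ω - vsPrime v vs ω, ω) = β (v - vs, ω))
    (hmp : ∀ v vs ω, m (vPrime v vs ω) ≤ m v + m vs) :
    ∫⁻ v, m v * ∫⁻ ω, ∫⁻ vs, β (v - vs, ω) *
        (g (vPrime v vs ω) * g (vsPrime v vs ω) + g v * g vs) ∂volume ∂sphMeasure ≤
      3 * (∫⁻ p, β p ∂((volume : Measure R3).prod sphMeasure)) * ∫⁻ v, m v * g v := by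
  have h1 := measurable_prime
  have h2 := measurable_sprime
  have hM : Measurable (fun p : (R3 × S2) × R3 => β (p.1.1 - p.2, p.1.2) *
        (g (vPrime p.1.1 p.2 p.1.2) * g (vsPrime p.1.1 p.2 p.1.2) + g p.1.1 * g p.2)) := by
    fun_prop
  have hM1 : Measurable (fun p : R3 × S2 => ∫⁻ vs, β (p.1 - vs, p.2) *
        (g (vPrime p.1 vs p.2) * g (vsPrime p.1 vs p.2) + g p.1 * g vs)) :=
    hM.lintegral_prod_right'
  have hM2 : Measurable (fun p : R3 × S2 => m p.1 * ∫⁻ vs, β (p.1 - vs, p.2) *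
        (g (vPrime p.1 vs p.2) * g (vsPrime p.1 vs p.2) + g p.1 * g vs)) :=
    (hm.comp measurable_fst).mul hM1
  calc _ = ∫⁻ v, ∫⁻ ω, m v * ∫⁻ vs, β (v - vs, ω) *
        (g (vPrime v vs ω) * g (vsPrime v vs ω) + g v * g vs) ∂volume ∂sphMeasure := by
        apply lintegral_congr
        intro v
        exact (lintegral_const_mul (m v) (hM1.comp (measurable_prodMk_left (x := v)))).symm
    _ = ∫⁻ ω, ∫⁻ v, m v * ∫⁻ vs, β (v - vs, ω) *
        (g (vPrime v vs ω) * g (vsPrime v vs ω) + g v * g vs) ∂volume ∂volume ∂sphMeasure :=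
        lintegral_lintegral_swap hM2.aemeasurable
    _ ≤ ∫⁻ ω, (∫⁻ w, β (w, ω)) * (3 * ∫⁻ v, m v * g v) ∂sphMeasure := by
        apply lintegral_mono
        intro ω
        have h3 := meas_vP ω
        have h4 := meas_vsP ω
        have e : ∀ v, m v * ∫⁻ vs, β (v - vs, ω) *
            (g (vPrime v vs ω) * g (vsPrime v vs ω) + g v * g vs) =
            (∫⁻ vs, m v * (β (v - vs, ω) * (g (vPrime v vs ω) * g (vsPrime v vs ω)))) +
            ∫⁻ vs, m v * (β (v - vs, ω) * (g v * g vs)) := by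
          intro v
          have h5 : Measurable (fun vs => vPrime v vs ω) := h3.comp measurable_prodMk_left
          have h6 : Measurable (fun vs => vsPrime v vs ω) := h4.comp measurable_prodMk_left
          rw [← lintegral_const_mul _ (by fun_prop), ← lintegral_add_left (by fun_prop)]
          apply lintegral_congr
          intro vs
          ring
        simp only [e]
        rw [lintegral_add_right _ (by fun_prop)]
        refine (add_le_add (bound_gain β g m hβ hg hm hg1 hsym hmp ω)
          (bound_one β g m hβ hg hm hg1 ω)).trans (le_of_eq ?_)
        ring
    _ = _ := by
        rw [lintegral_mul_const _ (by fun_prop), lintegral_prod_symm' _ hβ]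
        ring

end core

/-- If `0 ≤ f ≤ 1` is measurable with finite second moment and the collision kernel
satisfies `b(w,ω) = q(|w|, |w·ω|)`, then `∫ |v|² |Q(f)(v)| dv ≤ 3 B ∫ |v|² f(v) dv`. -/
theorem Qcoll_second_moment_bound
    (b : R3 × S2 → ℝ) (hb_meas : Measurable b) (hb_nonneg : ∀ p, 0 ≤ b p)
    (hb_int : Integrable b ((volume : Measure R3).prod sphMeasure))
    (hb_sym : ∃ q : ℝ × ℝ → ℝ, Measurable q ∧
      ∀ (w : R3) (ω : S2), b (w, ω) = q (‖w‖, |⟪w, (ω : R3)⟫|))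
    (B : ℝ) (hB : B = ∫ p, b p ∂((volume : Measure R3).prod sphMeasure))
    (f : R3 → ℝ) (hf_meas : Measurable f) (hf0 : ∀ v, 0 ≤ f v) (hf1 : ∀ v, f v ≤ 1)
    (hf_mom : Integrable (fun v => ‖v‖ ^ 2 * f v) (volume : Measure R3)) :
    Integrable (fun v => ‖v‖ ^ 2 * |Qcoll b f v|) (volume : Measure R3) ∧
    ∫ v, ‖v‖ ^ 2 * |Qcoll b f v| ∂(volume : Measure R3) ≤
      3 * B * ∫ v, ‖v‖ ^ 2 * f v ∂(volume : Measure R3) := by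
  obtain ⟨q, -, hq⟩ := hb_sym
  set β : R3 × S2 → ℝ≥0∞ := fun p => ENNReal.ofReal (b p) with hβd
  set g : R3 → ℝ≥0∞ := fun v => ENNReal.ofReal (f v) with hgd
  set m : R3 → ℝ≥0∞ := fun v => ENNReal.ofReal (‖v‖ ^ 2) with hmd
  have hβ : Measurable β := by fun_prop
  have hg : Measurable g := by fun_prop
  have hm : Measurable m := by fun_prop
  have hg1 : ∀ v, g v ≤ 1 := fun v => ENNReal.ofReal_le_one.2 (hf1 v)
  have hsym : ∀ v vs ω, β (vPrime v vs ω - vsPrime v vs ω, ω) = β (v - vs, ω) := by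
    intro v vs ω
    simp only [hβd, hq, norm_prime, inner_prime, abs_neg]
  have hmp : ∀ v vs ω, m (vPrime v vs ω) ≤ m v + m vs := by
    intro v vs ω
    simp only [hmd]
    rw [← ENNReal.ofReal_add (by positivity) (by positivity)]
    exact ENNReal.ofReal_le_ofReal (norm_vPrime_le v vs ω)
  have key := bound_total β g m hβ hg hm hg1 hsym hmp
  have hB0 : 0 ≤ B := hB ▸ integral_nonneg hb_nonneg
  have hBβ : ∫⁻ p, β p ∂((volume : Measure R3).prod sphMeasure) = ENNReal.ofReal B := by
    rw [hB, ofReal_integral_eq_lintegral_ofReal hb_int (ae_of_all _ hb_nonneg)]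
  have hnn : ∀ v, 0 ≤ ‖v‖ ^ 2 * f v := fun v => mul_nonneg (by positivity) (hf0 v)
  have hE0 : 0 ≤ ∫ v, ‖v‖ ^ 2 * f v := integral_nonneg hnn
  have hE : ∫⁻ v, m v * g v = ENNReal.ofReal (∫ v, ‖v‖ ^ 2 * f v) := by
    rw [ofReal_integral_eq_lintegral_ofReal hf_mom (ae_of_all _ hnn)]
    apply lintegral_congr
    intro v
    rw [ENNReal.ofReal_mul (by positivity)]
  have hR : 3 * (∫⁻ p, β p ∂((volume : Measure R3).prod sphMeasure)) * ∫⁻ v, m v * g v =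
      ENNReal.ofReal (3 * B * ∫ v, ‖v‖ ^ 2 * f v) := by
    rw [hBβ, hE, ENNReal.ofReal_mul (by positivity), ENNReal.ofReal_mul (by positivity)]
    simp
  have hpt : ∀ v, ENNReal.ofReal (‖v‖ ^ 2 * |Qcoll b f v|) ≤
      m v * ∫⁻ ω, ∫⁻ vs, β (v - vs, ω) *
        (g (vPrime v vs ω) * g (vsPrime v vs ω) + g v * g vs) ∂volume ∂sphMeasure := by
    intro v
    rw [ENNReal.ofReal_mul (by positivity)]
    gcongr
    rw [← Real.norm_eq_abs, ofReal_norm]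
    unfold Qcoll
    refine (enorm_integral_le_lintegral_enorm _).trans (lintegral_mono fun ω => ?_)
    refine (enorm_integral_le_lintegral_enorm _).trans (lintegral_mono fun vs => ?_)
    rw [← ofReal_norm, norm_mul, Real.norm_of_nonneg (hb_nonneg _),
      ENNReal.ofReal_mul (hb_nonneg _)]
    simp only [hβd, hgd]
    rw [← ENNReal.ofReal_mul (hf0 _), ← ENNReal.ofReal_mul (hf0 _),
      ← ENNReal.ofReal_add (mul_nonneg (hf0 _) (hf0 _)) (mul_nonneg (hf0 _) (hf0 _))]
    gcongr
    have aux : ∀ x y : ℝ, ∀ a c : R3, 0 ≤ x → 0 ≤ y →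
        0 ≤ x * y * (1 - f a) * (1 - f c) ∧ x * y * (1 - f a) * (1 - f c) ≤ x * y := by
      intro x y a c hx hy
      have ha := hf0 a
      have ha1 := hf1 a
      have hc := hf0 c
      have hc1 := hf1 c
      have hxy := mul_nonneg hx hy
      have h1 : 0 ≤ x * y * (1 - f a) := mul_nonneg hxy (by linarith)
      have h2 : x * y * (1 - f a) ≤ x * y := mul_le_of_le_one_right hxy (by linarith)
      exact ⟨mul_nonneg h1 (by linarith), (mul_le_of_le_one_right h1 (by linarith)).trans h2⟩
    have a1 := aux (f (vPrime v vs ω)) (f (vsPrime v vs ω)) v vs (hf0 _) (hf0 _)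
    have a2 := aux (f v) (f vs) (vPrime v vs ω) (vsPrime v vs ω) (hf0 _) (hf0 _)
    rw [Real.norm_eq_abs, abs_le]
    constructor <;> linarith [a1.1, a1.2, a2.1, a2.2]
  have hle := ((lintegral_mono hpt).trans key).trans_eq hR
  have hQm : StronglyMeasurable (Qcoll b f) := by
    have h1 := measurable_prime
    have h2 := measurable_sprime
    have hM : Measurable (fun p : (R3 × S2) × R3 => b (p.1.1 - p.2, p.1.2) *
        (f (vPrime p.1.1 p.2 p.1.2) * f (vsPrime p.1.1 p.2 p.1.2) * (1 - f p.1.1) * (1 - f p.2)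
          - f p.1.1 * f p.2 * (1 - f (vPrime p.1.1 p.2 p.1.2)) *
            (1 - f (vsPrime p.1.1 p.2 p.1.2)))) := by
      fun_prop
    exact (hM.stronglyMeasurable.integral_prod_right' (ν := volume)).integral_prod_right'
      (ν := sphMeasure)
  have hQm' := hQm.measurable
  have hmeas : AEStronglyMeasurable (fun v => ‖v‖ ^ 2 * |Qcoll b f v|) (volume : Measure R3) := by
    apply Measurable.aestronglyMeasurable
    exact (measurable_norm.pow_const 2).mul hQm'.abs
  have hnn2 : ∀ v, 0 ≤ ‖v‖ ^ 2 * |Qcoll b f v| := fun v => by positivity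
  refine ⟨⟨hmeas, ?_⟩, ?_⟩
  · rw [hasFiniteIntegral_iff_ofReal (ae_of_all _ hnn2)]
    exact hle.trans_lt ENNReal.ofReal_lt_top
  · rw [integral_eq_lintegral_of_nonneg_ae (ae_of_all _ hnn2) hmeas]
    exact ENNReal.toReal_le_of_le_ofReal (by positivity) hle
end
end

section
/- Let f, h ∈ L¹_loc((0,∞) × ℝ³ × ℝ³). Then the following are equivalent: (i) f solves the free transport equation with source, ∂_t f + v·∇_x f = h, in the sense of distributions, i.e. for every φ ∈ C_c^∞((0,∞) × ℝ³ × ℝ³) one has ∫∫∫ f(t,x,v) (∂_t φ + v·∇_x φ)(t,x,v) dt dx dv + ∫∫∫ h(t,x,v) φ(t,x,v) dt dx dv = 0; (ii) for almost every (x,v) ∈ ℝ³ × ℝ³, the function f^♯(t) := f(t, x + t v, v) coincides a.e. with a locally absolutely continuous function of t on (0,∞), the function h^♯(t) := h(t, x + t v, v) is in L¹_loc((0,∞)), and f^♯(t₂) - f^♯(t₁) = ∫_{t₁}^{t₂} h^♯(s) ds for all 0 < t₁ ≤ t₂. -/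
open MeasureTheory Metric
open scoped RealInnerProductSpace ENNReal

noncomputable section

lemma tr_integrable_mul {X : Type*} [TopologicalSpace X] [T2Space X] [MeasurableSpace X] [BorelSpace X]
    {μ : Measure X} {U : Set X} {k b : X → ℝ}
    (hk : LocallyIntegrableOn k U μ) (hb : Continuous b) (hbc : HasCompactSupport b)
    (hbU : tsupport b ⊆ U) : Integrable (fun x => k x * b x) μ := by
  have h1 : IntegrableOn k (tsupport b) μ := hk.integrableOn_compact_subset hbU hbc
  have h2 : IntegrableOn (fun x => k x * b x) (tsupport b) μ :=
    h1.mul_continuousOn hb.continuousOn hbc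
  refine (integrableOn_iff_integrable_of_support_subset ?_).1 h2
  intro x hx
  apply subset_tsupport
  intro h0
  apply hx
  simp [h0]

lemma tr_supp_bounds {a : ℝ → ℝ} (hc : HasCompactSupport a) (hs : tsupport a ⊆ Set.Ioi 0) :
    ∃ α β : ℝ, 0 < α ∧ α < β ∧ tsupport a ⊆ Set.Ioo α β := by
  have hc' : IsCompact (tsupport a) := hc
  rcases (tsupport a).eq_empty_or_nonempty with h | h
  · exact ⟨1, 2, by norm_num, by norm_num, by simp [h]⟩
  · obtain ⟨m, hm, hm'⟩ := hc'.exists_isLeast h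
    obtain ⟨M, hM, hM'⟩ := hc'.exists_isGreatest h
    have h0 : 0 < m := hs hm
    have := hm' hM
    refine ⟨m / 2, M + 1, by linarith, by linarith, fun x hx => ?_⟩
    have h1 := hm' hx
    have h2 := hM' hx
    constructor <;> linarith

lemma tr_intervalIntegrable {k : ℝ → ℝ} (hk : LocallyIntegrableOn k (Set.Ioi 0) volume)
    {s t : ℝ} (hs : 0 < s) (ht : 0 < t) : IntervalIntegrable k volume s t := by
  rw [intervalIntegrable_iff']
  refine hk.integrableOn_compact_subset ?_ isCompact_uIcc
  intro x hx
  have : min s t ≤ x := hx.1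
  have h2 : 0 < min s t := lt_min hs ht
  exact lt_of_lt_of_le h2 this

lemma tr_AC {k F : ℝ → ℝ} (hk : LocallyIntegrableOn k (Set.Ioi 0) volume)
    (hF : ∀ t₁ t₂ : ℝ, 0 < t₁ → t₁ ≤ t₂ → F t₂ - F t₁ = ∫ s in t₁..t₂, k s)
    {α β : ℝ} (hα : 0 < α) (hαβ : α < β) :
    ∃ G : ℝ → ℝ, (∀ x ∈ Set.Icc α β, F x = G x) ∧ AbsolutelyContinuousOnInterval G α β ∧
      (∀ᵐ x, x ∈ Set.Icc α β → deriv G x = k x) := by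
  refine ⟨fun x => (∫ s in α..x, k s) + F α, ?_, ?_, ?_⟩
  · intro x hx
    have := hF α x hα hx.1
    simp only; linarith
  · have hi := tr_intervalIntegrable hk hα (hα.trans hαβ)
    have h1 := hi.absolutelyContinuousOnInterval_intervalIntegral (c := α) (by simp)
    have h2 : AbsolutelyContinuousOnInterval (fun _ : ℝ => F α) α β := by
      have : LipschitzOnWith 0 (fun _ : ℝ => F α) (Set.uIcc α β) := 
        (LipschitzWith.const _).lipschitzOnWith
      exact this.absolutelyContinuousOnInterval
    exact h1.add h2
  · have hi := tr_intervalIntegrable hk hα (hα.trans hαβ)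
    filter_upwards [hi.ae_hasDerivAt_integral] with x hx hx'
    have := hx (by rwa [Set.uIcc_of_le hαβ.le]) α (by simp)
    exact (this.add_const (F α)).deriv

lemma tr_ibp {k F a : ℝ → ℝ} (hk : LocallyIntegrableOn k (Set.Ioi 0) volume)
    (hF : ∀ t₁ t₂ : ℝ, 0 < t₁ → t₁ ≤ t₂ → F t₂ - F t₁ = ∫ s in t₁..t₂, k s)
    (ha : ContDiff ℝ (⊤ : ℕ∞) a) (hc : HasCompactSupport a) (hs : tsupport a ⊆ Set.Ioi 0) :
    ∫ t, (F t * deriv a t + k t * a t) = 0 := by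
  obtain ⟨α, β, hα, hαβ, hab⟩ := tr_supp_bounds hc hs
  obtain ⟨G, hG1, hG2, hG3⟩ := tr_AC hk hF hα hαβ
  have haA : AbsolutelyContinuousOnInterval a α β := by
    obtain ⟨C, hC⟩ := (ha.of_le (by simp) : ContDiff ℝ 1 a).lipschitzWith_of_hasCompactSupport hc (by simp)
    exact hC.lipschitzOnWith.absolutelyContinuousOnInterval
  have h := hG2.integral_deriv_mul_eq_sub haA
  have z : ∀ x, x ∉ Set.Ioo α β → a x = 0 := fun x hx => image_eq_zero_of_notMem_tsupport (fun h => hx (hab h))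
  rw [z α (by simp), z β (by simp)] at h
  rw [← intervalIntegral.integral_eq_integral_of_support_subset (a := α) (b := β)]
  · rw [← sub_eq_zero.2 (rfl : (0:ℝ) = 0)]
    have e : ∫ x in α..β, (F x * deriv a x + k x * a x) = ∫ x in α..β, deriv G x * a x + G x * deriv a x := by
      apply intervalIntegral.integral_congr_ae
      filter_upwards [hG3] with x hx hx'
      rw [Set.uIoc_of_le hαβ.le] at hx'
      have := Set.Ioc_subset_Icc_self hx'
      rw [hx this, hG1 x this]; ring
    rw [e, h]; simp
  · intro x hx
    by_contra hx'
    apply hx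
    have h1 : x ∉ tsupport a := fun h => hx' (Set.Ioo_subset_Ioc_self (hab h))
    have h2 : deriv a x = 0 := image_eq_zero_of_notMem_tsupport (fun h => h1 (tsupport_deriv_subset h))
    simp [h2, image_eq_zero_of_notMem_tsupport h1]

/-- antiderivative test function -/
lemma tr_antideriv {a : ℝ → ℝ} (ha : ContDiff ℝ (⊤ : ℕ∞) a) (hc : HasCompactSupport a)
    (hs : tsupport a ⊆ Set.Ioi 0) (h0 : ∫ t, a t = 0) :
    ∃ A : ℝ → ℝ, ContDiff ℝ (⊤ : ℕ∞) A ∧ HasCompactSupport A ∧ tsupport A ⊆ Set.Ioi 0 ∧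
      deriv A = a := by
  obtain ⟨α, β, hα, hαβ, hab⟩ := tr_supp_bounds hc hs
  have z : ∀ x, x ∉ Set.Ioo α β → a x = 0 := fun x hx => image_eq_zero_of_notMem_tsupport (fun h => hx (hab h))
  have hd : deriv (fun x => ∫ s in α..x, a s) = a := by
    funext x
    exact ha.continuous.deriv_integral _ _ _
  have hsub : Function.support (fun x => ∫ s in α..x, a s) ⊆ Set.Icc α β := by
    intro x hx
    by_contra hx'
    apply hx
    rcases lt_or_ge x α with h | h
    · simp only
      rw [intervalIntegral.integral_congr (g := fun _ => (0:ℝ))]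
      · simp
      · intro s hs
        rw [Set.uIcc_of_ge h.le] at hs
        exact z s (fun h' => by linarith [hs.2, h'.1])
    · have hb : β < x := by
        by_contra hb; exact hx' ⟨h, not_lt.1 hb⟩
      simp only
      rw [intervalIntegral.integral_eq_integral_of_support_subset, h0]
      intro s hs
      by_contra hs'
      exact hs (z s (fun h' => hs' ⟨h'.1, by linarith [h'.2]⟩))
  refine ⟨fun x => ∫ s in α..x, a s, ?_, ?_, ?_, hd⟩
  · rw [contDiff_infty_iff_deriv, hd]
    refine ⟨fun x => ?_, ha⟩
    exact (intervalIntegral.integral_hasDerivAt_right (ha.continuous.intervalIntegrable _ _)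
      (ha.continuous.stronglyMeasurableAtFilter _ _) ha.continuous.continuousAt).differentiableAt
  · exact HasCompactSupport.of_support_subset_isCompact isCompact_Icc hsub
  · refine (closure_minimal hsub isClosed_Icc).trans ?_
    intro x hx
    exact lt_of_lt_of_le hα hx.1

lemma tr_bump : ∃ a : ℝ → ℝ, ContDiff ℝ (⊤ : ℕ∞) a ∧ HasCompactSupport a ∧
    tsupport a ⊆ Set.Ioi 0 ∧ ∫ t, a t = 1 := by
  let b : ContDiffBump (2:ℝ) := ⟨1/2, 1, by norm_num, by norm_num⟩
  refine ⟨b.normed volume, b.contDiff_normed, b.hasCompactSupport_normed, ?_, b.integral_normed⟩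
  rw [b.tsupport_normed_eq]
  intro x hx
  rw [Real.closedBall_eq_Icc] at hx
  have : (2:ℝ) - 1 ≤ x := hx.1
  show 0 < x
  linarith

lemma tr_duBois {g k : ℝ → ℝ} (hg : LocallyIntegrableOn g (Set.Ioi 0) volume)
    (hk : LocallyIntegrableOn k (Set.Ioi 0) volume)
    (H : ∀ a : ℝ → ℝ, ContDiff ℝ (⊤ : ℕ∞) a → HasCompactSupport a → tsupport a ⊆ Set.Ioi 0 →
      ∫ t, (g t * deriv a t + k t * a t) = 0) :
    ∃ F : ℝ → ℝ, (∀ᵐ t ∂(volume : Measure ℝ).restrict (Set.Ioi (0 : ℝ)), g t = F t) ∧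
      ∀ t₁ t₂ : ℝ, 0 < t₁ → t₁ ≤ t₂ → F t₂ - F t₁ = ∫ s in t₁..t₂, k s := by
  set K : ℝ → ℝ := fun t => ∫ s in (1:ℝ)..t, k s with hK
  have hKK : ∀ t₁ t₂ : ℝ, 0 < t₁ → t₁ ≤ t₂ → K t₂ - K t₁ = ∫ s in t₁..t₂, k s := by
    intro t₁ t₂ h1 h2
    exact intervalIntegral.integral_interval_sub_left
      (tr_intervalIntegrable hk one_pos (h1.trans_le h2)) (tr_intervalIntegrable hk one_pos h1)
  have hKc : ContinuousOn K (Set.Ioi 0) := by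
    intro x hx
    have hx : 0 < x := hx
    obtain ⟨G, hG1, hG2, -⟩ := tr_AC hk hKK (half_pos hx) (by linarith : x/2 < x + 1)
    have h1 := hG2.continuousOn
    rw [Set.uIcc_of_le (by linarith)] at h1
    have h2 : ContinuousOn K (Set.Icc (x/2) (x+1)) := h1.congr hG1
    exact (h2.continuousAt (Icc_mem_nhds (by linarith) (by linarith))).continuousWithinAt
  have hKl : LocallyIntegrableOn K (Set.Ioi 0) volume :=
    hKc.locallyIntegrableOn measurableSet_Ioi
  have hw : LocallyIntegrableOn (fun t => g t - K t) (Set.Ioi 0) volume := hg.sub hKl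
  have H1 : ∀ a : ℝ → ℝ, ContDiff ℝ (⊤ : ℕ∞) a → HasCompactSupport a → tsupport a ⊆ Set.Ioi 0 →
      ∫ t, (g t - K t) * deriv a t = 0 := by
    intro a ha hc hs
    have e1 := H a ha hc hs
    have e2 := tr_ibp hk hKK ha hc hs
    have hd : Continuous (deriv a) := ha.continuous_deriv (by simp)
    have hds : tsupport (deriv a) ⊆ Set.Ioi 0 := tsupport_deriv_subset.trans hs
    have i1 := tr_integrable_mul hg hd hc.deriv hds
    have i2 := tr_integrable_mul hKl hd hc.deriv hds
    have i3 := tr_integrable_mul hk ha.continuous hc hs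
    have := integral_sub (i1.add i3) (i2.add i3)
    simp only [Pi.add_apply] at this
    rw [e1, e2] at this
    rw [sub_zero] at this
    rw [← this]
    congr 1; funext t; ring
  obtain ⟨a0, h01, h02, h03, h04⟩ := tr_bump
  set c := ∫ t, (g t - K t) * a0 t with hcdef
  have hz : ∀ᵐ t, t ∈ Set.Ioi (0:ℝ) → g t - K t - c = 0 := by
    refine isOpen_Ioi.ae_eq_zero_of_integral_contDiff_smul_eq_zero
      (hw.sub (locallyIntegrableOn_const c)) ?_
    intro a ha hc hs
    set m := ∫ t, a t with hm
    have c1 : ContDiff ℝ (⊤ : ℕ∞) (fun t => m * a0 t) := contDiff_const.mul h01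
    have c2 : HasCompactSupport (fun t => m * a0 t) := h02.mul_left
    have c3 : tsupport (fun t => m * a0 t) ⊆ Set.Ioi 0 :=
      (tsupport_mul_subset_right (f := fun _ => m) (g := a0)).trans h03
    have ia : Integrable a := ha.continuous.integrable_of_hasCompactSupport hc
    have ia0 : Integrable a0 := h01.continuous.integrable_of_hasCompactSupport h02
    obtain ⟨A, A1, A2, A3, A4⟩ := tr_antideriv (a := fun t => a t - m * a0 t) (ha.sub c1)
      (hc.sub c2)
      ((tsupport_sub a (fun t => m * a0 t)).trans (Set.union_subset hs c3)) (by
        rw [integral_sub ia (ia0.const_mul m), integral_const_mul, h04]; simp [hm])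
    have e := H1 A A1 A2 A3
    rw [A4] at e
    have i1 := tr_integrable_mul hw ha.continuous hc hs
    have i2 := tr_integrable_mul hw h01.continuous h02 h03
    have e2 : ∫ t, (g t - K t) * (a t - m * a0 t)
      = (∫ t, (g t - K t) * a t) - m * c := by
      rw [hcdef, ← integral_const_mul, ← integral_sub i1 (i2.const_mul m)]
      congr 1; funext t; ring
    have e3 : ∫ t, a t • (g t - K t - c) = (∫ t, (g t - K t) * a t) - m * c := by
      rw [mul_comm m c, hm, ← integral_const_mul, ← integral_sub i1 (ia.const_mul c)]
      congr 1; funext t; simp only [smul_eq_mul]; ring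
    rw [e3, ← e2, e]
  refine ⟨fun t => K t + c, ?_, ?_⟩
  · rw [ae_restrict_iff' measurableSet_Ioi]
    filter_upwards [hz] with t ht ht'
    have := ht ht'
    linarith
  · intro t₁ t₂ h1 h2
    rw [← hKK t₁ t₂ h1 h2]; ring

def trI (n : ℕ) : Set ℝ := Set.Icc (1 / ((n:ℝ) + 1)) ((n:ℝ) + 1)

lemma trI_sub (n : ℕ) : trI n ⊆ Set.Ioi 0 := by
  intro x hx
  have : (0:ℝ) < 1 / ((n:ℝ) + 1) := by positivity
  exact lt_of_lt_of_le this hx.1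

lemma trI_exists {α β : ℝ} (hα : 0 < α) (r : ℝ) : ∃ n : ℕ, r ≤ n ∧ Set.Icc α β ⊆ trI n := by
  obtain ⟨n, hn⟩ := exists_nat_ge (max r (max (1/α) β))
  have h1 : r ≤ n := (le_max_left _ _).trans hn
  have h2 : 1/α ≤ n := ((le_max_left _ _).trans (le_max_right _ _)).trans hn
  have h3 : β ≤ n := ((le_max_right _ _).trans (le_max_right _ _)).trans hn
  refine ⟨n, h1, fun x hx => ⟨?_, by linarith [hx.2]⟩⟩
  refine le_trans ?_ hx.1
  rw [div_le_iff₀ (by positivity)]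
  rw [div_le_iff₀ hα] at h2
  nlinarith

def trT (n : ℕ) : Type :=
  {a : ℝ → ℝ // ContDiff ℝ (⊤ : ℕ∞) a ∧ HasCompactSupport a ∧ tsupport a ⊆ trI n}

def trIota (n : ℕ) (a : trT n) : C(trI n, ℝ) × C(trI n, ℝ) :=
  (⟨fun t => deriv a.1 t, (a.2.1.continuous_deriv (by simp)).comp continuous_subtype_val⟩,
   ⟨fun t => a.1 t, a.2.1.continuous.comp continuous_subtype_val⟩)

instance trCompact (n : ℕ) : CompactSpace (trI n) := isCompact_iff_compactSpace.1 isCompact_Icc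

instance trTop (n : ℕ) : TopologicalSpace (trT n) := TopologicalSpace.induced (trIota n) inferInstance

instance trSec (n : ℕ) : SecondCountableTopology (trT n) :=
  TopologicalSpace.secondCountableTopology_induced _ _ (trIota n)

lemma tr_cont_functional {X : Type*} [TopologicalSpace X] [CompactSpace X] [MeasurableSpace X]
    [BorelSpace X] {μ : Measure X} {g : X → ℝ} (hg : Integrable g μ) :
    Continuous (fun u : C(X, ℝ) => ∫ x, g x * u x ∂μ) := by
  have hi : ∀ u : C(X, ℝ), Integrable (fun x => g x * u x) μ := by
    intro u
    refine hg.mul_bdd (c := ‖u‖) u.continuous.aestronglyMeasurable ?_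
    exact Filter.Eventually.of_forall fun x => u.norm_coe_le_norm x
  have : LipschitzWith (Real.toNNReal (∫ x, ‖g x‖ ∂μ)) (fun u : C(X, ℝ) => ∫ x, g x * u x ∂μ) := by
    refine LipschitzWith.of_dist_le_mul fun u v => ?_
    rw [Real.coe_toNNReal _ (integral_nonneg fun x => norm_nonneg _), dist_eq_norm,
      ← integral_sub (hi u) (hi v), ← integral_mul_const]
    refine norm_integral_le_of_norm_le (hg.norm.mul_const _) ?_
    refine Filter.Eventually.of_forall fun x => ?_
    rw [← mul_sub, norm_mul]
    gcongr
    rw [← dist_eq_norm]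
    exact ContinuousMap.dist_apply_le_dist x
  exact this.continuous

lemma tr_functional {g k : ℝ → ℝ} (hg : LocallyIntegrableOn g (Set.Ioi 0) volume)
    (hk : LocallyIntegrableOn k (Set.Ioi 0) volume) (n : ℕ) :
    Continuous (fun a : trT n => ∫ t, (g t * deriv a.1 t + k t * a.1 t)) := by
  have hm : MeasurableSet (trI n) := measurableSet_Icc
  have key : ∀ g : ℝ → ℝ, LocallyIntegrableOn g (Set.Ioi 0) volume →
      Integrable (fun t : trI n => g t) (Measure.comap Subtype.val volume) := by
    intro g hg
    have := hg.integrableOn_compact_subset (trI_sub n) isCompact_Icc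
    exact (integrableOn_iff_comap_subtypeVal hm).1 this
  have c1 := tr_cont_functional (key g hg)
  have c2 := tr_cont_functional (key k hk)
  have c3 : Continuous (trIota n) := continuous_induced_dom
  have c4 := (c1.comp (continuous_fst.comp c3)).add (c2.comp (continuous_snd.comp c3))
  refine c4.congr fun a => ?_
  have ha := a.2.1
  have hd : Continuous (deriv a.1) := ha.continuous_deriv (by simp)
  have hs := a.2.2.2
  have hds : tsupport (deriv a.1) ⊆ trI n := tsupport_deriv_subset.trans hs
  have i1 := tr_integrable_mul hg hd a.2.2.1.deriv (hds.trans (trI_sub n))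
  have i2 := tr_integrable_mul hk ha.continuous a.2.2.1 (hs.trans (trI_sub n))
  rw [integral_add i1 i2]
  have e : ∀ g b : ℝ → ℝ, tsupport b ⊆ trI n →
      ∫ t : trI n, g t * b t ∂(Measure.comap Subtype.val volume) = ∫ t, g t * b t := by
    intro g b hb
    rw [integral_subtype_comap hm (fun t => g t * b t)]
    refine setIntegral_eq_integral_of_forall_compl_eq_zero fun x hx => ?_
    rw [image_eq_zero_of_notMem_tsupport (fun h => hx (hb h)), mul_zero]
  rw [← e g _ hds, ← e k _ hs]
  rfl

lemma tr_density {Q : Type*} [MeasurableSpace Q] {μ : Measure Q} {g k : ℝ × Q → ℝ}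
    (hg : ∀ᵐ q ∂μ, LocallyIntegrableOn (fun t => g (t, q)) (Set.Ioi 0) volume)
    (hk : ∀ᵐ q ∂μ, LocallyIntegrableOn (fun t => k (t, q)) (Set.Ioi 0) volume)
    (H : ∀ a : ℝ → ℝ, ContDiff ℝ (⊤ : ℕ∞) a → HasCompactSupport a → tsupport a ⊆ Set.Ioi 0 →
      ∀ᵐ q ∂μ, ∫ t, (g (t, q) * deriv a t + k (t, q) * a t) = 0) :
    ∀ᵐ q ∂μ, ∀ a : ℝ → ℝ, ContDiff ℝ (⊤ : ℕ∞) a → HasCompactSupport a →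
      tsupport a ⊆ Set.Ioi 0 → ∫ t, (g (t, q) * deriv a t + k (t, q) * a t) = 0 := by
  choose S hSc hSd using fun n => TopologicalSpace.exists_countable_dense (trT n)
  have h1 : ∀ᵐ q ∂μ, ∀ n : ℕ, ∀ a ∈ S n,
      ∫ t, (g (t, q) * deriv a.1 t + k (t, q) * a.1 t) = 0 := by
    rw [ae_all_iff]
    intro n
    rw [ae_ball_iff (hSc n)]
    intro a _
    exact H a.1 a.2.1 a.2.2.1 (a.2.2.2.trans (trI_sub n))
  filter_upwards [hg, hk, h1] with q hgq hkq hq a ha hc hs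
  obtain ⟨α, β, hα, hαβ, hab⟩ := tr_supp_bounds hc hs
  obtain ⟨n, -, hn⟩ := trI_exists (β := β) hα 0
  have hcl := isClosed_singleton.preimage (tr_functional hgq hkq n) (t := {(0:ℝ)})
  have := closure_minimal (s := S n) (fun a ha => hq n a ha) hcl
  rw [(hSd n).closure_eq] at this
  exact this (Set.mem_univ (⟨a, ha, hc, hab.trans (Set.Ioo_subset_Icc_self.trans hn)⟩ : trT n))

set_option linter.unusedSectionVars false

section prod
variable {E : Type*} [NormedAddCommGroup E] [NormedSpace ℝ E] [FiniteDimensional ℝ E]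
  [SecondCountableTopology E] [MeasureSpace E] [BorelSpace E]
  [SigmaFinite (volume : Measure E)] [IsLocallyFiniteMeasure (volume : Measure E)]

lemma tr_sections {g : ℝ × E → ℝ} (hg : LocallyIntegrableOn g {p : ℝ × E | 0 < p.1} volume) :
    ∀ᵐ q : E, LocallyIntegrableOn (fun t => g (t, q)) (Set.Ioi 0) volume := by
  have h1 : ∀ n : ℕ, ∀ᵐ q : E, q ∈ closedBall (0:E) n → IntegrableOn (fun t => g (t, q)) (trI n) := by
    intro n
    have : IntegrableOn g (trI n ×ˢ closedBall (0:E) n) volume := by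
      refine hg.integrableOn_compact_subset ?_ (isCompact_Icc.prod (isCompact_closedBall _ _))
      intro p hp
      exact trI_sub n hp.1
    rw [IntegrableOn, Measure.volume_eq_prod, ← Measure.prod_restrict] at this
    rw [← ae_restrict_iff' measurableSet_closedBall]
    exact this.prod_left_ae
  filter_upwards [ae_all_iff.2 h1] with q hq
  intro x hx
  have hx : 0 < x := hx
  obtain ⟨n, hn, hn'⟩ := trI_exists (α := x/2) (β := x+1) (half_pos hx) ‖q‖
  refine ⟨Set.Icc (x/2) (x+1), mem_nhdsWithin_of_mem_nhds (Icc_mem_nhds (by linarith) (by linarith)), ?_⟩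
  exact (hq n (by simpa using hn)).mono_set hn'

lemma tr_deriv_section {ψ : ℝ × E → ℝ} (hψ : ContDiff ℝ (⊤ : ℕ∞) ψ) (t : ℝ) (q : E) :
    deriv (fun s => ψ (s, q)) t = fderiv ℝ ψ (t, q) (1, 0) := by
  have h1 : HasFDerivAt ψ (fderiv ℝ ψ (t, q)) (t, q) :=
    (hψ.differentiable (by simp) _).hasFDerivAt
  have h2 : HasDerivAt (fun s : ℝ => (s, q)) ((1:ℝ), (0:E)) t :=
    (hasDerivAt_id t).prodMk (hasDerivAt_const t q)
  exact (h1.comp_hasDerivAt t h2).deriv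

lemma tr_dt {ψ : ℝ × E → ℝ} (hψ : ContDiff ℝ (⊤ : ℕ∞) ψ) (hc : HasCompactSupport ψ) :
    Continuous (fun p => fderiv ℝ ψ p ((1:ℝ), (0:E))) ∧
    HasCompactSupport (fun p => fderiv ℝ ψ p ((1:ℝ), (0:E))) ∧
    tsupport (fun p => fderiv ℝ ψ p ((1:ℝ), (0:E))) ⊆ tsupport ψ := by
  have hs : tsupport (fun p => fderiv ℝ ψ p ((1:ℝ), (0:E))) ⊆ tsupport ψ := by
    refine (closure_mono ?_).trans (tsupport_fderiv_subset ℝ (f := ψ))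
    intro p hp h0
    apply hp
    simp [h0]
  exact ⟨(hψ.continuous_fderiv (by simp)).clm_apply continuous_const,
    hc.of_isClosed_subset (isClosed_tsupport _) hs, hs⟩

lemma tr_integrable_test {g k : ℝ × E → ℝ}
    (hg : LocallyIntegrableOn g {p : ℝ × E | 0 < p.1} volume)
    (hk : LocallyIntegrableOn k {p : ℝ × E | 0 < p.1} volume)
    {ψ : ℝ × E → ℝ} (hψ : ContDiff ℝ (⊤ : ℕ∞) ψ) (hc : HasCompactSupport ψ)
    (hs : tsupport ψ ⊆ {p : ℝ × E | 0 < p.1}) :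
    Integrable (fun p => g p * fderiv ℝ ψ p ((1:ℝ), (0:E)) + k p * ψ p)
      ((volume : Measure ℝ).prod (volume : Measure E)) := by
  obtain ⟨h1, h2, h3⟩ := tr_dt hψ hc
  exact (tr_integrable_mul hg h1 h2 (h3.trans hs)).add (tr_integrable_mul hk hψ.continuous hc hs)

lemma tr_prod_mpr {g k : ℝ × E → ℝ}
    (hg : LocallyIntegrableOn g {p : ℝ × E | 0 < p.1} volume)
    (hk : LocallyIntegrableOn k {p : ℝ × E | 0 < p.1} volume)
    (H : ∀ᵐ q : E, ∃ F : ℝ → ℝ,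
        (∀ᵐ t ∂(volume : Measure ℝ).restrict (Set.Ioi (0 : ℝ)), g (t, q) = F t) ∧
        LocallyIntegrableOn (fun t => k (t, q)) (Set.Ioi (0 : ℝ)) volume ∧
        ∀ t₁ t₂ : ℝ, 0 < t₁ → t₁ ≤ t₂ → F t₂ - F t₁ = ∫ s in t₁..t₂, k (s, q))
    {ψ : ℝ × E → ℝ} (hψ : ContDiff ℝ (⊤ : ℕ∞) ψ) (hc : HasCompactSupport ψ)
    (hs : tsupport ψ ⊆ {p : ℝ × E | 0 < p.1}) :
    ∫ p, (g p * fderiv ℝ ψ p ((1:ℝ), (0:E)) + k p * ψ p) = 0 := by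
  rw [Measure.volume_eq_prod, integral_prod_symm _ (tr_integrable_test hg hk hψ hc hs)]
  apply integral_eq_zero_of_ae
  filter_upwards [H] with q ⟨F, hF1, hF2, hF3⟩
  have a1 : ContDiff ℝ (⊤ : ℕ∞) (fun t => ψ (t, q)) := hψ.comp (contDiff_id.prodMk contDiff_const)
  have hsub : tsupport (fun t => ψ (t, q)) ⊆ (fun t : ℝ => (t, q)) ⁻¹' tsupport ψ :=
    closure_minimal (fun t ht => subset_tsupport _ ht)
      ((isClosed_tsupport ψ).preimage (by fun_prop))
  have a3 : tsupport (fun t => ψ (t, q)) ⊆ Set.Ioi 0 := fun t ht => hs (hsub ht)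
  have a2 : HasCompactSupport (fun t => ψ (t, q)) := by
    have hcc : IsCompact (tsupport ψ) := hc
    refine (hcc.image continuous_fst).of_isClosed_subset (isClosed_tsupport _) ?_
    intro t ht
    exact ⟨(t, q), hsub ht, rfl⟩
  have e := tr_ibp hF2 hF3 a1 a2 a3
  simp only [Pi.zero_apply]
  rw [← e]
  apply integral_congr_ae
  rw [ae_restrict_iff' measurableSet_Ioi] at hF1
  filter_upwards [hF1] with t ht
  rw [← tr_deriv_section hψ]
  by_cases h0 : 0 < t
  · rw [ht h0]
  · have : t ∉ tsupport (deriv fun t => ψ (t, q)) :=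
      fun h => h0 (a3 (tsupport_deriv_subset h))
    rw [image_eq_zero_of_notMem_tsupport this]; simp

lemma tr_prod_mp {g k : ℝ × E → ℝ}
    (hg : LocallyIntegrableOn g {p : ℝ × E | 0 < p.1} volume)
    (hk : LocallyIntegrableOn k {p : ℝ × E | 0 < p.1} volume)
    (H : ∀ ψ : ℝ × E → ℝ, ContDiff ℝ (⊤ : ℕ∞) ψ → HasCompactSupport ψ →
      tsupport ψ ⊆ {p : ℝ × E | 0 < p.1} →
      ∫ p, (g p * fderiv ℝ ψ p ((1:ℝ), (0:E)) + k p * ψ p) = 0) :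
    ∀ᵐ q : E, ∃ F : ℝ → ℝ,
        (∀ᵐ t ∂(volume : Measure ℝ).restrict (Set.Ioi (0 : ℝ)), g (t, q) = F t) ∧
        LocallyIntegrableOn (fun t => k (t, q)) (Set.Ioi (0 : ℝ)) volume ∧
        ∀ t₁ t₂ : ℝ, 0 < t₁ → t₁ ≤ t₂ → F t₂ - F t₁ = ∫ s in t₁..t₂, k (s, q) := by
  have sg := tr_sections hg
  have sk := tr_sections hk
  have key := tr_density sg sk ?_
  · filter_upwards [sg, sk, key] with q h1 h2 h3
    obtain ⟨F, hF1, hF2⟩ := tr_duBois h1 h2 h3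
    exact ⟨F, hF1, h2, hF2⟩
  intro a ha hac has
  -- tensor products
  have tens : ∀ b : E → ℝ, ContDiff ℝ (⊤ : ℕ∞) b → HasCompactSupport b →
      Integrable (fun q => b q • ∫ t, (g (t, q) * deriv a t + k (t, q) * a t)) ∧
      ∫ q, b q • ∫ t, (g (t, q) * deriv a t + k (t, q) * a t) = 0 := by
    intro b hb hbc
    set ψ : ℝ × E → ℝ := fun p => a p.1 * b p.2 with hψdef
    have hψ : ContDiff ℝ (⊤ : ℕ∞) ψ := (ha.comp contDiff_fst).mul (hb.comp contDiff_snd)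
    have hsub : tsupport ψ ⊆ tsupport a ×ˢ tsupport b := by
      refine closure_minimal ?_ ((isClosed_tsupport a).prod (isClosed_tsupport b))
      intro p hp
      have : a p.1 * b p.2 ≠ 0 := hp
      exact ⟨subset_tsupport _ (left_ne_zero_of_mul this), subset_tsupport _ (right_ne_zero_of_mul this)⟩
    have hψc : HasCompactSupport ψ :=
      (IsCompact.prod hac hbc).of_isClosed_subset (isClosed_tsupport _) hsub
    have hψs : tsupport ψ ⊆ {p : ℝ × E | 0 < p.1} := fun p hp => has (hsub hp).1
    have hi := tr_integrable_test hg hk hψ hψc hψs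
    have hz := H ψ hψ hψc hψs
    have e : ∀ q : E, ∫ t, (g (t, q) * fderiv ℝ ψ (t, q) ((1:ℝ), (0:E)) + k (t, q) * ψ (t, q))
        = b q • ∫ t, (g (t, q) * deriv a t + k (t, q) * a t) := by
      intro q
      rw [smul_eq_mul, ← integral_const_mul]
      congr 1; funext t
      rw [← tr_deriv_section hψ]
      simp only [hψdef]
      rw [deriv_mul_const (ha.differentiable (by simp) t)]
      ring
    constructor
    · refine hi.integral_prod_right.congr ?_
      exact Filter.Eventually.of_forall e
    · rw [Measure.volume_eq_prod, integral_prod_symm _ hi] at hz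
      rw [← hz]
      congr 1; funext q; exact (e q).symm
  refine ae_eq_zero_of_integral_contDiff_smul_eq_zero ?_ fun b hb hbc => (tens b hb hbc).2
  intro q
  let b : ContDiffBump q := ⟨1, 2, by norm_num, by norm_num⟩
  refine ⟨closedBall q 1, closedBall_mem_nhds _ one_pos, ?_⟩
  refine ((tens b b.contDiff b.hasCompactSupport).1.integrableOn (s := closedBall q 1)).congr_fun ?_ measurableSet_closedBall
  intro y hy
  simp only
  rw [b.one_of_mem_closedBall hy, one_smul]
end prod
/-- The free transport flow as a homeomorphism of phase space-time. -/
def trPhi : (ℝ × R3 × R3) ≃ₜ (ℝ × R3 × R3) where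
  toFun p := (p.1, p.2.1 + p.1 • p.2.2, p.2.2)
  invFun p := (p.1, p.2.1 - p.1 • p.2.2, p.2.2)
  left_inv p := by simp
  right_inv p := by simp
  continuous_toFun := by fun_prop
  continuous_invFun := by fun_prop

lemma trPhi_apply (p : ℝ × R3 × R3) : trPhi p = (p.1, p.2.1 + p.1 • p.2.2, p.2.2) := rfl

lemma trPhi_symm_apply (p : ℝ × R3 × R3) :
    trPhi.symm p = (p.1, p.2.1 - p.1 • p.2.2, p.2.2) := rfl

lemma trPhi_contDiff : ContDiff ℝ (⊤ : ℕ∞) trPhi := by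
  show ContDiff ℝ (⊤ : ℕ∞) (fun p : ℝ × R3 × R3 => (p.1, p.2.1 + p.1 • p.2.2, p.2.2))
  fun_prop

lemma trPhi_symm_contDiff : ContDiff ℝ (⊤ : ℕ∞) trPhi.symm := by
  show ContDiff ℝ (⊤ : ℕ∞) (fun p : ℝ × R3 × R3 => (p.1, p.2.1 - p.1 • p.2.2, p.2.2))
  fun_prop

lemma tr_shear (t : ℝ) : MeasurePreserving (fun q : R3 × R3 => (q.1 + t • q.2, q.2)) volume volume := by
  have h1 : MeasurePreserving (fun q : R3 × R3 => (q.1, q.2 + t • q.1))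
      ((volume : Measure R3).prod (volume : Measure R3))
      ((volume : Measure R3).prod (volume : Measure R3)) := by
    refine (MeasurePreserving.id (volume : Measure R3)).skew_product
      (g := fun v x => x + t • v) ?_ ?_
    · have : Continuous (fun q : R3 × R3 => q.2 + t • q.1) := by fun_prop
      exact this.measurable
    · exact Filter.Eventually.of_forall fun v => map_add_right_eq_self _ _
  have h2 := Measure.measurePreserving_swap (μ := (volume : Measure R3)) (ν := (volume : Measure R3))
  exact h2.comp (h1.comp h2)

lemma trPhi_mp : MeasurePreserving trPhi volume volume := by
  refine (MeasurePreserving.id (volume : Measure ℝ)).skew_product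
      (g := fun t (q : R3 × R3) => (q.1 + t • q.2, q.2)) ?_ ?_
  · have : Continuous (fun p : ℝ × R3 × R3 => (p.2.1 + p.1 • p.2.2, p.2.2)) := by fun_prop
    exact this.measurable
  · exact Filter.Eventually.of_forall fun t => (tr_shear t).map_eq

lemma trPhi_locInt {f : ℝ × R3 × R3 → ℝ}
    (hf : LocallyIntegrableOn f {p : ℝ × R3 × R3 | 0 < p.1} volume) :
    LocallyIntegrableOn (fun p => f (trPhi p)) {p : ℝ × R3 × R3 | 0 < p.1} volume := by
  have ho : IsOpen {p : ℝ × R3 × R3 | 0 < p.1} := isOpen_lt continuous_const continuous_fst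
  rw [locallyIntegrableOn_iff ho.isLocallyClosed]
  intro K hK hKc
  have h1 : IntegrableOn f (trPhi '' K) volume := by
    refine hf.integrableOn_compact_subset ?_ (hKc.image trPhi.continuous)
    rintro _ ⟨p, hp, rfl⟩
    have h0 : 0 < p.1 := hK hp
    exact h0
  have h2 := (trPhi_mp.integrableOn_comp_preimage trPhi.measurableEmbedding).2 h1
  rwa [Set.preimage_image_eq _ trPhi.injective] at h2

lemma trPhi_fderiv {φ : ℝ × R3 × R3 → ℝ} (hφ : ContDiff ℝ (⊤ : ℕ∞) φ) (p : ℝ × R3 × R3) :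
    fderiv ℝ (fun p => φ (trPhi p)) p ((1:ℝ), (0 : R3 × R3))
      = fderiv ℝ φ (trPhi p) ((1:ℝ), (trPhi p).2.2, (0:R3)) := by
  obtain ⟨t, x, v⟩ := p
  have hc : ContDiff ℝ (⊤ : ℕ∞) (fun p => φ (trPhi p)) := hφ.comp trPhi_contDiff
  rw [← tr_deriv_section hc]
  have h1 : HasFDerivAt φ (fderiv ℝ φ (trPhi (t, x, v))) (trPhi (t, x, v)) :=
    (hφ.differentiable (by simp) _).hasFDerivAt
  have h2 : HasDerivAt (fun s : ℝ => trPhi (s, x, v)) ((1:ℝ), v, (0:R3)) t := by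
    have h3 : HasDerivAt (fun s : ℝ => x + s • v) v t := by
      simpa using ((hasDerivAt_id t).smul_const v).const_add x
    exact (hasDerivAt_id t).prodMk (h3.prodMk (hasDerivAt_const t v))
  exact (h1.comp_hasDerivAt t h2).deriv

lemma trPhi_integral (f h : ℝ × R3 × R3 → ℝ) {φ : ℝ × R3 × R3 → ℝ}
    (hφ : ContDiff ℝ (⊤ : ℕ∞) φ) :
    ∫ p : ℝ × R3 × R3, (f p * fderiv ℝ φ p ((1 : ℝ), p.2.2, (0 : R3)) + h p * φ p)
    = ∫ p : ℝ × R3 × R3, (f (trPhi p) * fderiv ℝ (fun p => φ (trPhi p)) p ((1:ℝ), (0 : R3 × R3))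
        + h (trPhi p) * φ (trPhi p)) := by
  rw [← trPhi_mp.integral_comp trPhi.measurableEmbedding]
  congr 1; funext p
  rw [trPhi_fderiv hφ]

lemma tr_test_comp (e : (ℝ × R3 × R3) ≃ₜ (ℝ × R3 × R3)) (he : ∀ p, (e p).1 = p.1)
    {φ : ℝ × R3 × R3 → ℝ} (hc : HasCompactSupport φ)
    (hs : tsupport φ ⊆ {p : ℝ × R3 × R3 | 0 < p.1}) :
    HasCompactSupport (fun p => φ (e p)) ∧
    tsupport (fun p => φ (e p)) ⊆ {p : ℝ × R3 × R3 | 0 < p.1} := by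
  refine ⟨hc.comp_homeomorph e, ?_⟩
  have hsub : tsupport (fun p => φ (e p)) ⊆ e ⁻¹' tsupport φ :=
    closure_minimal (fun t ht => subset_tsupport _ ht)
      ((isClosed_tsupport φ).preimage e.continuous)
  intro p hp
  have : 0 < (e p).1 := hs (hsub hp)
  rwa [he] at this

theorem transport_distributional_iff_mild
    (f h : ℝ × R3 × R3 → ℝ)
    (hf_loc : LocallyIntegrableOn f {p : ℝ × R3 × R3 | 0 < p.1} volume)
    (hh_loc : LocallyIntegrableOn h {p : ℝ × R3 × R3 | 0 < p.1} volume) :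
    (∀ φ : ℝ × R3 × R3 → ℝ, ContDiff ℝ (⊤ : ℕ∞) φ → HasCompactSupport φ →
        tsupport φ ⊆ {p : ℝ × R3 × R3 | 0 < p.1} →
        ∫ p : ℝ × R3 × R3,
            (f p * fderiv ℝ φ p ((1 : ℝ), p.2.2, (0 : R3)) + h p * φ p) = 0) ↔
      (∀ᵐ q : R3 × R3 ∂(volume : Measure (R3 × R3)), ∃ F : ℝ → ℝ,
        (∀ᵐ t ∂(volume : Measure ℝ).restrict (Set.Ioi (0 : ℝ)),
          f (t, q.1 + t • q.2, q.2) = F t) ∧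
        LocallyIntegrableOn (fun t => h (t, q.1 + t • q.2, q.2)) (Set.Ioi (0 : ℝ)) volume ∧
        ∀ t₁ t₂ : ℝ, 0 < t₁ → t₁ ≤ t₂ →
          F t₂ - F t₁ = ∫ s in t₁..t₂, h (s, q.1 + s • q.2, q.2)) := by
  have hf' := trPhi_locInt hf_loc
  have hh' := trPhi_locInt hh_loc
  constructor
  · intro H
    refine tr_prod_mp hf' hh' fun ψ hψ hc hs => ?_
    obtain ⟨c1, c2⟩ := tr_test_comp trPhi.symm (fun _ => rfl) hc hs
    have hφ : ContDiff ℝ (⊤ : ℕ∞) (fun p => ψ (trPhi.symm p)) := hψ.comp trPhi_symm_contDiff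
    have := H _ hφ c1 c2
    rw [trPhi_integral f h hφ] at this
    simpa only [Homeomorph.symm_apply_apply] using this
  · intro H φ hφ hc hs
    obtain ⟨c1, c2⟩ := tr_test_comp trPhi (fun _ => rfl) hc hs
    rw [trPhi_integral f h hφ]
    exact tr_prod_mpr hf' hh' H (hφ.comp trPhi_contDiff) c1 c2
end
end
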